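/- arXiv:gr-qc/0703134 — 2 statements merged into one kernel-verified Lean document; each statement's English description precedes it below -/
import Mathlib

section
/- Let f : A → B be a topological embedding. Then for every x ∈ A, the image f(x) lies in the topological interior of f(A) in B if and only if x ∉ ∂A; consequently the manifold interior A − ∂A coincides with the preimage of the topological interior of f(A), and f maps ∂A into the topological frontier of f(A) in B. -/
section InvarianceOfDomain

open Set Metric MeasureTheory Module
open scoped NNReal Topology

section
variable {E : Type*} [NormedAddCommGroup E]

/-- Lagrange interpolation expresses `det (1 + M)` through the values `det (1 + t • M)` at
arbitrarily small `t`, with weights which do not depend on `M`. -/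
theorem exists_weights_det_one_add_smul [NormedSpace ℝ E] [FiniteDimensional ℝ E] {ε : ℝ}
    (hε : 0 < ε) :
    ∃ t c : Fin (finrank ℝ E + 1) → ℝ, (∀ i, 0 ≤ t i ∧ t i < ε) ∧ ∑ i, c i = 1 ∧
      ∀ M : E →L[ℝ] E, (1 + M).det = ∑ i, c i * (1 + t i • M).det := by
  set d := finrank ℝ E with hd
  let t : Fin (d + 1) → ℝ := fun i => ε * (i / (d + 1))
  have htinj : Function.Injective t := by
    intro i j hij
    have hd0 : (d : ℝ) + 1 ≠ 0 := by positivity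
    simp only [t] at hij
    field_simp at hij
    exact Fin.ext (by exact_mod_cast hij)
  have hs : Set.InjOn t (Finset.univ : Finset (Fin (d + 1))) := htinj.injOn
  refine ⟨t, fun i => (Lagrange.basis Finset.univ t i).eval 1, fun i => ⟨by positivity, ?_⟩, ?_, ?_⟩
  · have : (i : ℝ) / (d + 1) < 1 := by
      rw [div_lt_one (by positivity)]
      exact_mod_cast i.2
    nlinarith
  · rw [← Polynomial.eval_finsetSum, Lagrange.sum_basis hs Finset.univ_nonempty,
      Polynomial.eval_one]
  · intro M
    let b := finBasis ℝ E
    let A := LinearMap.toMatrix b b (M : E →ₗ[ℝ] E)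
    let p : Polynomial ℝ := Matrix.det ((Polynomial.X : Polynomial ℝ) • A.map Polynomial.C +
      (1 : Matrix _ _ ℝ).map Polynomial.C)
    have hp (s : ℝ) : p.eval s = (1 + s • M).det := by
      have h1 : (1 + s • M).det = Matrix.det (s • A + 1) := by
        rw [ContinuousLinearMap.det, ← LinearMap.det_toMatrix b]
        congr 1
        rw [ContinuousLinearMap.toLinearMap_add, ContinuousLinearMap.toLinearMap_smul, map_add,
          map_smul, add_comm]
        exact congrArg _ (LinearMap.toMatrix_one b)
      rw [h1, ← Polynomial.coe_evalRingHom, RingHom.map_det]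
      congr 1
      ext i j
      by_cases hij : i = j
      · simp [hij, mul_comm s]
      · simp [hij, mul_comm s]
    have hdeg : p.degree < (Finset.univ : Finset (Fin (d + 1))).card := by
      refine (Polynomial.degree_le_of_natDegree_le
        (Polynomial.natDegree_det_X_add_C_le A 1)).trans_lt ?_
      simp only [Fintype.card_fin, Finset.card_univ]
      exact_mod_cast Nat.lt_succ_self d
    have h := congrArg (Polynomial.eval 1) (Lagrange.eq_interpolate hs hdeg)
    rw [Lagrange.interpolate_apply, Polynomial.eval_finsetSum, hp, one_smul] at h
    rw [h]
    refine Finset.sum_congr rfl fun i _ => ?_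
    rw [Polynomial.eval_mul, Polynomial.eval_C, hp, mul_comm]

theorem bijective_add_smul [NormedSpace ℝ E] [CompleteSpace E] {u : E → E} {L : ℝ≥0}
    (hu : LipschitzWith L u) {t : ℝ} (ht : 0 ≤ t) (htL : t * L < 1) :
    Function.Bijective fun x => x + t • u x := by
  have hlip (y : E) : LipschitzWith (t.toNNReal * L) fun x => y - t • u x := by
    refine LipschitzWith.of_dist_le_mul fun a b => ?_
    rw [dist_sub_left, dist_smul₀, Real.norm_of_nonneg ht, NNReal.coe_mul,
      Real.coe_toNNReal t ht, mul_assoc]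
    exact mul_le_mul_of_nonneg_left (hu.dist_le_mul a b) ht
  have hK : (t.toNNReal * L : ℝ≥0) < 1 := by
    rwa [← NNReal.coe_lt_coe, NNReal.coe_mul, Real.coe_toNNReal t ht]
  have hfix (x y : E) : Function.IsFixedPt (fun z => y - t • u z) x ↔ x + t • u x = y := by
    rw [Function.IsFixedPt, sub_eq_iff_eq_add, eq_comm]
  constructor
  · intro a b hab
    exact ContractingWith.fixedPoint_unique' ⟨hK, hlip (b + t • u b)⟩ ((hfix a _).2 hab)
      ((hfix b _).2 rfl)
  · intro y
    have hc : ContractingWith _ _ := ⟨hK, hlip y⟩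
    exact ⟨_, (hfix _ _).1 hc.fixedPoint_isFixedPt⟩

theorem det_one_add_smul_pos [NormedSpace ℝ E] [FiniteDimensional ℝ E] {M : E →L[ℝ] E} {L : ℝ}
    (hM : ‖M‖ ≤ L) {t : ℝ} (ht : 0 ≤ t) (htL : t * L < 1) : 0 < (1 + t • M).det := by
  have hne : ∀ s ∈ Icc 0 t, (1 + s • M).det ≠ 0 := by
    intro s hs h0
    have hL : 0 ≤ L := (norm_nonneg _).trans hM
    obtain ⟨v, hv, hv0⟩ := Submodule.exists_mem_ne_zero_of_ne_bot
      (LinearMap.bot_lt_ker_of_det_eq_zero h0).ne'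
    have h1 : v + s • M v = 0 := by simpa using hv
    have h2 : ‖v‖ = s * ‖M v‖ := by
      rw [eq_neg_of_add_eq_zero_left h1, norm_neg, norm_smul, Real.norm_of_nonneg hs.1]
      congr 2
      rw [← eq_neg_of_add_eq_zero_left h1]
    have h3 : ‖M v‖ ≤ L * ‖v‖ := M.le_of_opNorm_le hM v
    have h4 : 0 < ‖v‖ := norm_pos_iff.2 hv0
    have h5 : s * ‖M v‖ ≤ t * (L * ‖v‖) := mul_le_mul hs.2 h3 (norm_nonneg _) ht
    nlinarith
  by_contra! hneg
  have hcont : ContinuousOn (fun s : ℝ => (1 + s • M).det) (Icc 0 t) :=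
    (ContinuousLinearMap.continuous_det.comp
      (by fun_prop : Continuous fun s : ℝ => 1 + s • M)).continuousOn
  obtain ⟨s, hs, hs0⟩ := intermediate_value_Icc' ht hcont
    (show (0 : ℝ) ∈ _ from ⟨hneg, by simp [ContinuousLinearMap.det]⟩)
  exact hne s hs hs0

/-- A Lipschitz map of the unit ball, differentiable in the open ball and fixing the sphere,
cannot send the open ball into the sphere. -/
theorem not_lipschitz_retraction [InnerProductSpace ℝ E] [FiniteDimensional ℝ E] {u : E → E}
    {L : ℝ≥0} (hu : LipschitzWith L u) (hd : DifferentiableOn ℝ u (ball 0 1))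
    (h0 : ∀ x, x ∉ ball (0 : E) 1 → u x = 0) (h1 : ∀ x ∈ ball (0 : E) 1, ‖x + u x‖ = 1) :
    False := by
  borelize E
  set B : Set E := ball 0 1 with hB
  let μ : Measure E := Measure.addHaar
  have hdx {x : E} (hx : x ∈ B) : HasFDerivAt u (fderiv ℝ u x) x :=
    (hd.differentiableAt (isOpen_ball.mem_nhds hx)).hasFDerivAt
  have hε : 0 < 1 / ((L : ℝ) + 1) := by positivity
  have key {t : ℝ} (ht : 0 ≤ t) (ht' : t < 1 / ((L : ℝ) + 1)) :
      IntegrableOn (fun x => (1 + t • fderiv ℝ u x).det) B μ ∧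
      ∫ x in B, (1 + t • fderiv ℝ u x).det ∂μ = μ.real B := by
    have htL : t * L < 1 := by
      rw [lt_div_iff₀ (by positivity)] at ht'
      nlinarith
    have hbij := bijective_add_smul hu ht htL
    set f : E → E := fun x => x + t • u x with hf
    have himage : f '' B = B := by
      have hc : f '' Bᶜ = Bᶜ := by
        have : EqOn f id Bᶜ := fun x hx => by simp [hf, h0 x hx]
        rw [this.image_eq, image_id]
      rw [← compl_inj_iff, ← image_compl_eq hbij, hc]
    have hderiv : ∀ x ∈ B, HasFDerivWithinAt f (1 + t • fderiv ℝ u x) B x := fun x hx =>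
      ((hasFDerivAt_id x).add ((hdx hx).const_smul t)).hasFDerivWithinAt
    have habs : ∀ x ∈ B, |(1 + t • fderiv ℝ u x).det| • (1 : ℝ) = (1 + t • fderiv ℝ u x).det := by
      intro x _
      rw [abs_of_pos (det_one_add_smul_pos (norm_fderiv_le_of_lipschitz ℝ hu) ht htL),
        smul_eq_mul, mul_one]
    have hint := (integrableOn_image_iff_integrableOn_abs_det_fderiv_smul μ measurableSet_ball
      hderiv hbij.1.injOn (fun _ => (1 : ℝ))).1 (by
        rw [himage]; exact integrableOn_const measure_ball_lt_top.ne)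
    have heq := integral_image_eq_integral_abs_det_fderiv_smul μ measurableSet_ball
      hderiv hbij.1.injOn (fun _ => (1 : ℝ))
    rw [setIntegral_congr_fun measurableSet_ball habs, himage] at heq
    refine ⟨hint.congr_fun habs measurableSet_ball, heq.symm.trans ?_⟩
    simp
  have hdet : ∀ x ∈ B, (1 + fderiv ℝ u x).det = 0 := by
    intro x hx
    by_contra hne
    have hg : HasFDerivAt (fun y => y + u y) (1 + fderiv ℝ u x) x :=
      (hasFDerivAt_id x).add (hdx hx)
    have hn := hg.norm_sq
    have hc : (fun y => ‖y + u y‖ ^ 2) =ᶠ[𝓝 x] fun _ => 1 := by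
      filter_upwards [isOpen_ball.mem_nhds hx] with y hy
      rw [h1 y hy, one_pow]
    have hz := hn.unique ((hasFDerivAt_const (1 : ℝ) x).congr_of_eventuallyEq hc)
    have hsurj : Function.Surjective (1 + fderiv ℝ u x : E →L[ℝ] E) :=
      (LinearMap.equivOfDetNeZero _ hne).surjective
    obtain ⟨v, hv⟩ := hsurj (x + u x)
    have := DFunLike.congr_fun hz v
    simp only [smul_apply, ContinuousLinearMap.comp_apply, hv,
      innerSL_apply_apply, real_inner_self_eq_norm_sq, h1 x hx] at this
    norm_num at this
  obtain ⟨t, c, ht, hc, hsum⟩ := exists_weights_det_one_add_smul (E := E) hε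
  have hzero : ∫ x in B, (1 + fderiv ℝ u x).det ∂μ = 0 :=
    setIntegral_eq_zero_of_forall_eq_zero hdet
  rw [funext fun x => hsum (fderiv ℝ u x)] at hzero
  rw [integral_finsetSum _ fun i _ => (key (ht i).1 (ht i).2).1.const_mul _] at hzero
  simp_rw [integral_const_mul, (key (ht _).1 (ht _).2).2] at hzero
  rw [← Finset.sum_mul, hc, one_mul] at hzero
  exact (ENNReal.toReal_pos (measure_ball_pos μ (0 : E) one_pos).ne'
    measure_ball_lt_top.ne).ne' hzero

end

section
variable {E : Type*} [NormedAddCommGroup E]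

theorem lipschitzWith_indicator_ball [NormedSpace ℝ E] {v : E → E} {L : ℝ≥0}
    (hv : LipschitzOnWith L v (closedBall 0 1)) (h0 : ∀ x, ‖x‖ = 1 → v x = 0) :
    LipschitzWith L ((ball (0 : E) 1).indicator v) := by
  set w := (ball (0 : E) 1).indicator v with hw
  have hin {x : E} (hx : ‖x‖ ≤ 1) : w x = v x := by
    rcases hx.lt_or_eq with h | h
    · exact indicator_of_mem (mem_ball_zero_iff.2 h) v
    · rw [h0 x h, hw, indicator_of_notMem (by simp [h])]
  have hout {x : E} (hx : 1 ≤ ‖x‖) : w x = 0 := indicator_of_notMem (by simpa using hx) v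
  have hmix {x y : E} (hx : ‖x‖ ≤ 1) (hy : 1 ≤ ‖y‖) : dist (w x) (w y) ≤ L * dist x y := by
    have hc : ContinuousOn (fun s : ℝ => ‖AffineMap.lineMap x y s‖) (Icc 0 1) := by fun_prop
    obtain ⟨s, hs, hs1⟩ := intermediate_value_Icc zero_le_one hc
      (show (1 : ℝ) ∈ _ by simpa using ⟨hx, hy⟩)
    set z := AffineMap.lineMap x y s with hz
    have hs1 : ‖z‖ = 1 := hs1
    have hd : dist x z ≤ dist x y := by
      rw [hz, dist_left_lineMap, Real.norm_of_nonneg hs.1]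
      exact mul_le_of_le_one_left dist_nonneg hs.2
    rw [hout hy, ← h0 z hs1, hin hx]
    exact (hv.dist_le_mul _ (by simpa using hx) _ (by simp [hs1])).trans
      (mul_le_mul_of_nonneg_left hd L.2)
  refine LipschitzWith.of_dist_le_mul fun x y => ?_
  rcases le_total ‖x‖ 1 with hx | hx <;> rcases le_total ‖y‖ 1 with hy | hy
  · rw [hin hx, hin hy]
    exact hv.dist_le_mul _ (by simpa using hx) _ (by simpa using hy)
  · exact hmix hx hy
  · rw [dist_comm, dist_comm x]; exact hmix hy hx
  · rw [hout hx, hout hy, dist_self]; positivity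

variable [InnerProductSpace ℝ E] [FiniteDimensional ℝ E]

theorem ContDiff.exists_eq_zero_of_eqOn_id {K : E → E} (hK : ContDiff ℝ 1 K)
    (hid : ∀ x, 1 ≤ ‖x‖ → K x = x) : ∃ x, K x = 0 := by
  by_contra! hne
  set v : E → E := fun x => ‖K x‖⁻¹ • K x - x with hv
  have hvd : ContDiff ℝ 1 v :=
    (((hK.norm ℝ hne).inv fun x => norm_ne_zero_iff.2 (hne x)).smul hK).sub contDiff_id
  obtain ⟨L, hL⟩ := hvd.contDiffOn.exists_lipschitzOnWith one_ne_zero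
    (convex_closedBall (0 : E) 1) (isCompact_closedBall 0 1)
  refine not_lipschitz_retraction (lipschitzWith_indicator_ball hL fun x hx => ?_) ?_
    (fun x hx => indicator_of_notMem hx v) fun x hx => ?_
  · simp [hv, hid x hx.ge, hx]
  · exact (hvd.differentiable one_ne_zero).differentiableOn.congr fun x hx => indicator_of_mem hx v
  · rw [indicator_of_mem hx v]
    simp [hv, norm_smul, hne x]

theorem exists_eq_zero_of_norm_sub_le {h : E → E} (hc : ContinuousOn h (closedBall 0 1))
    (hh : ∀ x ∈ closedBall (0 : E) 1, ‖h x - x‖ ≤ 1 / 2) : ∃ x ∈ closedBall (0 : E) 1, h x = 0 := by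
  by_contra! hne
  obtain ⟨δ, hδ, hδh⟩ : ∃ δ > 0, ∀ x ∈ closedBall (0 : E) 1, δ ≤ ‖h x‖ := by
    obtain ⟨x₀, hx₀, hmin⟩ := (isCompact_closedBall (0 : E) 1).exists_isMinOn
      ⟨0, by simp⟩ hc.norm
    exact ⟨‖h x₀‖, norm_pos_iff.2 (hne x₀ hx₀), fun x hx => hmin hx⟩
  obtain ⟨g, hg⟩ := ContinuousMap.exists_restrict_eq (isClosed_closedBall (x := (0 : E)) (ε := 1))
    ⟨_, hc.domRestrict⟩
  have hgh {x : E} (hx : x ∈ closedBall (0 : E) 1) : g x = h x := DFunLike.congr_fun hg ⟨x, hx⟩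
  obtain ⟨H, hHd, hH, -⟩ := g.continuous.exists_contDiff_approx 1 (ε := fun _ => min δ (1 / 4))
    continuous_const fun _ => lt_min hδ (by norm_num)
  have hHx {x : E} (hx : x ∈ closedBall (0 : E) 1) : ‖H x - h x‖ < min δ (1 / 4) := by
    rw [← hgh hx, ← dist_eq_norm]; exact hH x
  let φ : ContDiffBump (0 : E) := ⟨7 / 8, 1, by norm_num, by norm_num⟩
  have hφ0 {x : E} (hx : 1 ≤ ‖x‖) : φ x = 0 := φ.zero_of_le_dist (by simpa using hx)
  obtain ⟨x, hx⟩ := ContDiff.exists_eq_zero_of_eqOn_id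
    (K := fun x => x + φ x • (H x - x))
    (contDiff_id.add (φ.contDiff.smul (hHd.sub contDiff_id))) fun x hx => by simp [hφ0 hx]
  rcases le_or_gt 1 ‖x‖ with h1 | h1
  · rw [hφ0 h1, zero_smul, add_zero] at hx
    rw [hx, norm_zero] at h1
    norm_num at h1
  have hxB : x ∈ closedBall (0 : E) 1 := by simpa using h1.le
  have hlt := hHx hxB
  rcases le_or_gt ‖x‖ (7 / 8) with h2 | h2
  · rw [φ.one_of_mem_closedBall (by simpa [φ] using h2), one_smul, add_sub_cancel] at hx
    rw [hx, zero_sub, norm_neg] at hlt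
    exact (hδh x hxB).not_gt (hlt.trans_le (min_le_left _ _))
  · have h3 : ‖H x - x‖ ≤ 1 / 4 + 1 / 2 :=
      (norm_sub_le_norm_sub_add_norm_sub (H x) (h x) x).trans
        (add_le_add (hlt.le.trans (min_le_right _ _)) (hh x hxB))
    have h4 : ‖x‖ = φ x * ‖H x - x‖ := by
      conv_lhs => rw [eq_neg_of_add_eq_zero_left hx, norm_neg, norm_smul,
        Real.norm_of_nonneg φ.nonneg]
    have h5 : φ x * ‖H x - x‖ ≤ 1 * ‖H x - x‖ :=
      mul_le_mul_of_nonneg_right φ.le_one (norm_nonneg _)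
    linarith

/-- **Invariance of domain**, at the centre of a ball. -/
theorem mem_interior_image_closedBall {f : E → E} (hf : ContinuousOn f (closedBall 0 1))
    (hinj : InjOn f (closedBall 0 1)) : f 0 ∈ interior (f '' closedBall 0 1) := by
  by_contra hnot
  borelize E
  set B : Set E := closedBall 0 1 with hB
  have hBc : IsCompact B := isCompact_closedBall 0 1
  have h0B : (0 : E) ∈ B := by simp [hB]
  have hemb : Topology.IsClosedEmbedding (B.domRestrict f) :=
    have : CompactSpace B := isCompact_iff_compactSpace.1 hBc
    hf.domRestrict.isClosedEmbedding hinj.injective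
  obtain ⟨G, hG⟩ := ContinuousMap.exists_extension' hemb ⟨Subtype.val, continuous_subtype_val⟩
  have hGf {x : E} (hx : x ∈ B) : G (f x) = x := congr_fun hG ⟨x, hx⟩
  obtain ⟨ε, hε, hεG⟩ : ∃ ε > 0, ∀ y, ‖y - f 0‖ ≤ 2 * ε → ‖G y‖ ≤ 1 / 10 := by
    have h1 := G.continuous.continuousAt (x := f 0)
    obtain ⟨ε, hε, h⟩ := Metric.continuousAt_iff.1 h1 (1 / 10) (by norm_num)
    refine ⟨ε / 3, by positivity, fun y hy => ?_⟩
    have := h (x := y) (by rw [dist_eq_norm]; linarith)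
    rw [hGf h0B, dist_zero_right] at this
    exact this.le
  obtain ⟨c, hcball, hc⟩ : ∃ c ∈ ball (f 0) ε, c ∉ f '' B := by
    by_contra! h
    exact hnot (mem_interior.2 ⟨_, h, isOpen_ball, mem_ball_self hε⟩)
  have hfc {x : E} (hx : x ∈ B) : f x - c ≠ 0 := fun h => hc ⟨x, hx, sub_eq_zero.1 h⟩
  have hnear {y : E} (hy : ‖y - c‖ ≤ ε) : ‖G y‖ ≤ 1 / 10 := by
    refine hεG y ((norm_sub_le_norm_sub_add_norm_sub y c (f 0)).trans ?_)
    rw [mem_ball_iff_norm] at hcball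
    linarith
  obtain ⟨δ, hδ, hδG⟩ : ∃ δ > 0, ∀ x ∈ B, ε ≤ ‖f x - c‖ → δ ≤ ‖x‖ := by
    have h1 : ContinuousAt (fun x : B => ‖f x - c‖) ⟨0, h0B⟩ :=
      ((hf.domRestrict.sub continuous_const).norm).continuousAt
    have h2 : ∀ᶠ x : B in 𝓝 ⟨0, h0B⟩, ‖f x - c‖ < ε := by
      refine h1.eventually_lt_const ?_
      rw [mem_ball_iff_norm'] at hcball
      exact hcball
    obtain ⟨δ, hδ, h⟩ := Metric.eventually_nhds_iff.1 h2
    refine ⟨δ, hδ, fun x hx hεx => ?_⟩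
    by_contra! hlt
    exact hεx.not_gt (h (y := ⟨x, hx⟩) (by simpa [Subtype.dist_eq] using hlt))
  set η := min (δ / 2) (1 / 10) with hη
  have hηpos : 0 < η := lt_min (by positivity) (by norm_num)
  obtain ⟨P, hPd, hP, -⟩ := G.continuous.exists_contDiff_approx 1 (ε := fun _ => η / 2)
    continuous_const fun _ => by positivity
  obtain ⟨a, haη, ha⟩ : ∃ a ∈ ball (0 : E) (η / 2), a ∉ P '' sphere c ε := by
    by_contra! h
    let μ : Measure E := Measure.addHaar
    have hnull : μ (P '' sphere c ε) = 0 :=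
      addHaar_image_eq_zero_of_differentiableOn_of_addHaar_eq_zero μ
        (hPd.differentiable one_ne_zero).differentiableOn
        (Measure.addHaar_sphere_of_ne_zero μ c hε.ne')
    exact (measure_ball_pos μ (0 : E) (by positivity : 0 < η / 2)).ne' (measure_mono_null h hnull)
  have hPG (y : E) : ‖P y - a - G y‖ < η := by
    have h1 := hP y
    rw [dist_eq_norm] at h1
    rw [mem_ball_zero_iff] at haη
    have h2 := norm_sub_le (P y - G y) a
    rw [sub_right_comm]
    linarith
  let r : E → ℝ := fun x => max (ε / ‖f x - c‖) 1
  let Φ : E → E := fun x => c + r x • (f x - c)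
  have hΦfar {x : E} (hx : x ∈ B) (h : ε ≤ ‖f x - c‖) : Φ x = f x := by
    have : ε / ‖f x - c‖ ≤ 1 := (div_le_one (norm_pos_iff.2 (hfc hx))).2 h
    simp [Φ, r, this]
  have hΦnear {x : E} (hx : x ∈ B) (h : ‖f x - c‖ ≤ ε) : ‖Φ x - c‖ = ε := by
    have hpos := norm_pos_iff.2 (hfc hx)
    have : 1 ≤ ε / ‖f x - c‖ := (one_le_div hpos).2 h
    simp only [Φ, r, max_eq_left this, add_sub_cancel_left, norm_smul, norm_div, norm_norm,
      Real.norm_of_nonneg hε.le]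
    field_simp
  have hΦc : ContinuousOn Φ B := by
    have h1 : ContinuousOn (fun x => f x - c) B := hf.sub continuousOn_const
    exact continuousOn_const.add (((continuousOn_const.div h1.norm
      fun x hx => norm_ne_zero_iff.2 (hfc hx)).sup continuousOn_const).smul h1)
  obtain ⟨x, hx, hx0⟩ := exists_eq_zero_of_norm_sub_le (h := fun x => P (Φ x) - a)
    ((hPd.continuous.comp_continuousOn hΦc).sub continuousOn_const) fun x hx => by
      have h1 := hPG (Φ x)
      have h2 : η ≤ 1 / 10 := min_le_right _ _
      rcases le_total ε ‖f x - c‖ with h | h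
      · rw [hΦfar hx h, hGf hx] at h1
        rw [hΦfar hx h]
        linarith
      · have h3 := hnear (hΦnear hx h).le
        have h4 := hnear h
        rw [hGf hx] at h4
        have h5 := norm_add₃_le (a := P (Φ x) - a - G (Φ x)) (b := G (Φ x)) (c := -x)
        rw [norm_neg, sub_add_cancel, ← sub_eq_add_neg] at h5
        linarith
  rcases le_total ε ‖f x - c‖ with h | h
  · have h1 := hPG (f x)
    rw [hΦfar hx h] at hx0
    rw [hx0, hGf hx, zero_sub, norm_neg] at h1
    have h2 := hδG x hx h
    have h3 : η ≤ δ / 2 := min_le_left _ _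
    linarith
  · exact ha ⟨Φ x, mem_sphere_iff_norm.2 (hΦnear hx h), sub_eq_zero.1 hx0⟩

/-- **Invariance of domain**: an injective continuous map of a finite-dimensional space to itself
sends neighbourhoods to neighbourhoods. -/
theorem Set.InjOn.image_mem_nhds_of_continuousOn {f : E → E} {s : Set E} (hinj : InjOn f s)
    (hf : ContinuousOn f s) {x : E} (hs : s ∈ 𝓝 x) : f '' s ∈ 𝓝 (f x) := by
  obtain ⟨ρ, hρ, hρs⟩ := Metric.nhds_basis_closedBall.mem_iff.1 hs
  let e : E → E := fun y => x + ρ • y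
  have he : MapsTo e (closedBall 0 1) s := fun y hy => hρs <| by
    rw [mem_closedBall_zero_iff] at hy
    simpa [e, norm_smul, abs_of_pos hρ] using mul_le_of_le_one_right hρ.le hy
  have hei : Function.Injective e := fun y z h => smul_right_injective E hρ.ne' (add_left_cancel h)
  have h := mem_interior_image_closedBall (f := f ∘ e)
    (hf.comp (by fun_prop) he) (hinj.comp hei.injOn he)
  rw [Function.comp_apply, show e 0 = x by simp [e], mem_interior_iff_mem_nhds, image_comp] at h
  exact Filter.mem_of_superset h (image_mono he.image_subset)

end

open scoped Manifold in
/-- Under an embedding of an `n`-manifold with boundary in an `n`-manifold without boundary, the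
points landing in the interior of the range are the interior points. -/
theorem mem_interior_range_iff_isInteriorPoint {n : ℕ} [NeZero n]
    {A : Type*} [TopologicalSpace A] [ChartedSpace (EuclideanHalfSpace n) A]
    {B : Type*} [TopologicalSpace B] [ChartedSpace (EuclideanSpace ℝ (Fin n)) B]
    {f : A → B} (hf : Topology.IsEmbedding f) (x : A) :
    f x ∈ interior (range f) ↔ (𝓡∂ n).IsInteriorPoint x := by
  let φ := extChartAt (𝓡∂ n) x
  let ψ := chartAt (EuclideanSpace ℝ (Fin n)) (f x)
  have hψx : f x ∈ ψ.source := mem_chart_source _ _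
  constructor
  · intro hx
    have : Nonempty A := ⟨x⟩
    let g := Function.invFun f
    have hgf (a : A) : g (f a) = a := Function.leftInverse_invFun hf.injective a
    have hg : ContinuousOn g (range f) := by
      rw [hf.continuousOn_iff]
      exact continuousOn_id.congr fun b ⟨a, ha⟩ => by simp [← ha, hgf]
    have hgi : InjOn g (range f) := by
      rintro _ ⟨a, rfl⟩ _ ⟨b, rfl⟩ h
      rw [hgf, hgf] at h
      rw [h]
    let s : Set (EuclideanSpace ℝ (Fin n)) := ψ.target ∩ ψ.symm ⁻¹' (range f ∩ g ⁻¹' φ.source)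
    have hψs : ψ.symm (ψ (f x)) = f x := ψ.left_inv hψx
    have hs : s ∈ 𝓝 (ψ (f x)) := by
      refine Filter.inter_mem (ψ.open_target.mem_nhds (ψ.map_source hψx))
        ((ψ.continuousAt_symm (ψ.map_source hψx)).preimage_mem_nhds ?_)
      have hr : range f ∈ 𝓝 (f x) := mem_interior_iff_mem_nhds.1 hx
      rw [hψs]
      refine Filter.inter_mem hr ((hg.continuousAt hr).preimage_mem_nhds ?_)
      rw [hgf]
      exact extChartAt_source_mem_nhds x
    have hinj : InjOn (φ ∘ g ∘ ψ.symm) s :=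
      φ.injOn.comp (hgi.comp (ψ.symm.injOn.mono inter_subset_left) fun y hy => hy.2.1)
        fun y hy => hy.2.2
    have hcont : ContinuousOn (φ ∘ g ∘ ψ.symm) s :=
      (continuousOn_extChartAt x).comp (hg.comp
        (ψ.continuousOn_symm.mono inter_subset_left) fun y hy => hy.2.1) fun y hy => hy.2.2
    have h := hinj.image_mem_nhds_of_continuousOn hcont hs
    simp only [Function.comp_apply, hψs, hgf] at h
    refine mem_interior_iff_mem_nhds.2 (Filter.mem_of_superset h ?_)
    rintro _ ⟨y, hy, rfl⟩
    exact extChartAt_target_subset_range x (φ.map_source hy.2.2)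
  · intro hx
    let s : Set (EuclideanSpace ℝ (Fin n)) := φ.target ∩ (f ∘ φ.symm) ⁻¹' ψ.source
    have hφt : φ.target ∈ 𝓝 (φ x) :=
      mem_interior_iff_mem_nhds.1 (ModelWithCorners.isInteriorPoint_iff.1 hx)
    have hφs : φ.symm (φ x) = x := extChartAt_to_inv x
    have hs : s ∈ 𝓝 (φ x) := by
      refine Filter.inter_mem hφt
        ((hf.continuous.continuousAt.comp (continuousAt_extChartAt_symm x)).preimage_mem_nhds ?_)
      rw [Function.comp_apply, hφs]
      exact ψ.open_source.mem_nhds hψx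
    have hinj : InjOn (ψ ∘ f ∘ φ.symm) s :=
      ψ.injOn.comp (hf.injective.comp_injOn (φ.symm.injOn.mono inter_subset_left)) fun y hy => hy.2
    have hcont : ContinuousOn (ψ ∘ f ∘ φ.symm) s :=
      ψ.continuousOn.comp (hf.continuous.comp_continuousOn
        ((continuousOn_extChartAt_symm x).mono inter_subset_left)) fun y hy => hy.2
    have h := hinj.image_mem_nhds_of_continuousOn hcont hs
    simp only [Function.comp_apply, hφs] at h
    have h2 := (ψ.continuousAt hψx).preimage_mem_nhds h
    refine mem_interior_iff_mem_nhds.2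
      (Filter.mem_of_superset (Filter.inter_mem h2 (ψ.open_source.mem_nhds hψx)) ?_)
    rintro b ⟨⟨y, hy, hyb⟩, hb⟩
    exact ⟨φ.symm y, ψ.injOn hy.2 hb hyb⟩

end InvarianceOfDomain

/-- Let `A` be a Hausdorff topological `n`-manifold with boundary (charted on the
Euclidean half-space), `B` a Hausdorff topological `n`-manifold without boundary
(charted on Euclidean space), and `f : A → B` a topological embedding. Then a point
`f x` lies in the topological interior of the image `f(A)` iff `x` is not a boundary
point of `A`; consequently the manifold interior of `A` is the preimage of the
topological interior of `f(A)`, and `f` maps the boundary `∂A` into the topological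
frontier of `f(A)` in `B`. -/
theorem embedding_interior_boundary {n : ℕ} [NeZero n]
    {A : Type*} [TopologicalSpace A] [T2Space A]
    [ChartedSpace (EuclideanHalfSpace n) A]
    {B : Type*} [TopologicalSpace B] [T2Space B]
    [ChartedSpace (EuclideanSpace ℝ (Fin n)) B]
    (f : A → B) (hf : Topology.IsEmbedding f) :
    (∀ x : A, f x ∈ interior (Set.range f) ↔
        x ∉ (modelWithCornersEuclideanHalfSpace n).boundary A) ∧
      (modelWithCornersEuclideanHalfSpace n).interior A = f ⁻¹' interior (Set.range f) ∧
      f '' (modelWithCornersEuclideanHalfSpace n).boundary A ⊆ frontier (Set.range f) := by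
  have key := mem_interior_range_iff_isInteriorPoint (n := n) hf
  have hb (x : A) := ModelWithCorners.isInteriorPoint_iff_not_isBoundaryPoint
    (I := modelWithCornersEuclideanHalfSpace n) x
  refine ⟨fun x => (key x).trans (hb x), Set.ext fun x => (key x).symm, ?_⟩
  rintro _ ⟨x, hx, rfl⟩
  exact ⟨subset_closure (Set.mem_range_self x), fun h => (hb x).1 ((key x).1 h) hx⟩
end

section
/- Suppose there are an open set U ⊆ (0, ∞) × ℝ², a smooth map e defined on U with values in the symmetric 2×2 real matrices of determinant 1, and a nowhere-vanishing function ρ̄ : ℝ² → ℝ, such that for every (r, y¹, y²) ∈ U the matrix g(0, r, y¹, y²) has entries g₀₀ = g₁₁ = 0, g₀₁ = g₁₀ = −1, g₀ᵢ = gᵢ₀ = g₁ᵢ = gᵢ₁ = 0 for i ∈ {2, 3}, and g₍₂₊ᵢ₎₍₂₊ⱼ₎(0, r, y¹, y²) = r²·ρ̄(y¹, y²)·e(r, y¹, y²)ᵢⱼ for i, j ∈ {0, 1}. Then for every (r, y¹, y²) ∈ U one has R₁₁(0, r, y¹, y²) = (2/r)·Γ¹₁₁(0, r, y¹, y²) +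 ¼·trace( ∂ᵣe(r, y¹, y²) · ∂ᵣ(e⁻¹)(r, y¹, y²) ), and moreover Γ¹₁₁(0, r, y¹, y²) = ½·∂₀g₁₁(0, r, y¹, y²). (This is the identity behind the statement that on the null hypersurface the Einstein equation G_rr = 0 is equivalent to Γʳ_rr = −(r/8)·∂ᵣe_{ij}·∂ᵣe^{ij}.) -/
/-- The partial derivative `∂_μ f` of a function `f : ℝ⁴ → ℝ` along the `μ`-th
coordinate direction. -/
noncomputable def coordDeriv (μ : Fin 4) (f : (Fin 4 → ℝ) → ℝ) (x : Fin 4 → ℝ) : ℝ :=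
  fderiv ℝ f x (Pi.single μ 1)

/-- The Christoffel symbols of a metric `g`:
`Γ^σ_{μν} = ½ Σ_τ (g⁻¹)_{στ}(∂_μ g_{τν} + ∂_ν g_{τμ} − ∂_τ g_{μν})`. -/
noncomputable def Christoffel (g : (Fin 4 → ℝ) → Matrix (Fin 4) (Fin 4) ℝ)
    (σ μ ν : Fin 4) (x : Fin 4 → ℝ) : ℝ :=
  (1 / 2) * ∑ τ : Fin 4, (g x)⁻¹ σ τ *
    (coordDeriv μ (fun y => g y τ ν) x + coordDeriv ν (fun y => g y τ μ) x
      - coordDeriv τ (fun y => g y μ ν) x)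

/-- The Ricci tensor of a metric `g`:
`R_{μν} = Σ_α ∂_α Γ^α_{μν} − Σ_α ∂_ν Γ^α_{αμ}
  + Σ_{α,β}(Γ^α_{αβ} Γ^β_{μν} − Γ^α_{νβ} Γ^β_{αμ})`. -/
noncomputable def Ricci (g : (Fin 4 → ℝ) → Matrix (Fin 4) (Fin 4) ℝ)
    (μ ν : Fin 4) (x : Fin 4 → ℝ) : ℝ :=
  (∑ α : Fin 4, coordDeriv α (Christoffel g α μ ν) x)
    - (∑ α : Fin 4, coordDeriv ν (Christoffel g α α μ) x)
    + ∑ α : Fin 4, ∑ β : Fin 4,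
        (Christoffel g α α β x * Christoffel g β μ ν x
          - Christoffel g α ν β x * Christoffel g β α μ x)

open Filter Topology

lemma coordDeriv_eq_of_hasDerivAt {F : (Fin 4 → ℝ) → ℝ} {x : Fin 4 → ℝ} {μ : Fin 4}
    {f : ℝ → ℝ} {f' : ℝ} (hF : DifferentiableAt ℝ F x) (hf : HasDerivAt f f' (x μ))
    (heq : (fun s => F (Function.update x μ s)) =ᶠ[𝓝 (x μ)] f) : coordDeriv μ F x = f' := by
  have hF' : HasFDerivAt F (fderiv ℝ F x) (Function.update x μ (x μ)) := by
    rw [Function.update_eq_self]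
    exact hF.hasFDerivAt
  exact (hF'.comp_hasDerivAt (x μ) (hasDerivAt_update x μ (x μ))).unique
    (hf.congr_of_eventuallyEq heq)

lemma coordDeriv_one_of_slice {U : Set (ℝ × ℝ × ℝ)} (hU : IsOpen U)
    {F : (Fin 4 → ℝ) → ℝ} {f : ℝ × ℝ × ℝ → ℝ} {f' : ℝ}
    (hF : Differentiable ℝ F) (hFf : ∀ q ∈ U, F ![0, q.1, q.2.1, q.2.2] = f q)
    {p : ℝ × ℝ × ℝ} (hp : p ∈ U) (hf : HasDerivAt (fun s => f (s, p.2)) f' p.1) :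
    coordDeriv 1 F ![0, p.1, p.2.1, p.2.2] = f' := by
  refine coordDeriv_eq_of_hasDerivAt (hF _) hf ?_
  have hmem : ∀ᶠ s in 𝓝 p.1, (s, p.2) ∈ U :=
    (by fun_prop : Continuous fun s : ℝ => (s, p.2)).continuousAt.eventually
      (hU.mem_nhds hp)
  filter_upwards [hmem] with s hs
  rw [← hFf _ hs]
  congr 1
  ext i
  fin_cases i <;> simp [Function.update]

lemma coordDeriv_eq_zero_of_slice_const {U : Set (ℝ × ℝ × ℝ)} (hU : IsOpen U)
    {F : (Fin 4 → ℝ) → ℝ} {c : ℝ} (hF : Differentiable ℝ F)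
    (hFc : ∀ q ∈ U, F ![0, q.1, q.2.1, q.2.2] = c)
    {p : ℝ × ℝ × ℝ} (hp : p ∈ U) {μ : Fin 4} (hμ : μ ≠ 0) :
    coordDeriv μ F ![0, p.1, p.2.1, p.2.2] = 0 := by
  refine coordDeriv_eq_of_hasDerivAt (hF _) (hasDerivAt_const _ c) ?_
  set x : Fin 4 → ℝ := ![0, p.1, p.2.1, p.2.2]
  have hcont : ContinuousAt (fun s => ((Function.update x μ s 1, Function.update x μ s 2,
      Function.update x μ s 3) : ℝ × ℝ × ℝ)) (x μ) := by
    have h := (hasDerivAt_update x μ (x μ)).continuousAt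
    rw [continuousAt_pi] at h
    exact (h 1).prodMk ((h 2).prodMk (h 3))
  have hmem := hcont.eventually (hU.mem_nhds (by simpa [x] using hp))
  filter_upwards [hmem] with s hs
  rw [← hFc _ hs]
  congr 1
  ext i
  fin_cases i
  · simp [Function.update_of_ne hμ.symm, x]
  all_goals rfl

lemma contDiff_coordDeriv {F : (Fin 4 → ℝ) → ℝ} (hF : ContDiff ℝ (⊤ : ℕ∞) F) (μ : Fin 4) :
    ContDiff ℝ (⊤ : ℕ∞) (coordDeriv μ F) := by
  unfold coordDeriv
  exact (hF.fderiv_right (m := (⊤ : ℕ∞)) (by simp)).clm_apply contDiff_const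

lemma coordDeriv_comm {F : (Fin 4 → ℝ) → ℝ} (hF : ContDiff ℝ (⊤ : ℕ∞) F)
    (μ ν : Fin 4) (x : Fin 4 → ℝ) :
    coordDeriv μ (coordDeriv ν F) x =
      coordDeriv ν (coordDeriv μ F) x := by
  have hd : DifferentiableAt ℝ (fderiv ℝ F) x :=
    (hF.fderiv_right (m := 1) (by norm_cast)).differentiable (by simp) x
  have hs : IsSymmSndFDerivAt ℝ F x :=
    hF.contDiffAt.isSymmSndFDerivAt (by
      simp only [minSmoothness_of_isRCLikeNormedField]
      norm_cast)
  have key : ∀ α β, coordDeriv α (coordDeriv β F) x =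
      fderiv ℝ (fderiv ℝ F) x (Pi.single α 1) (Pi.single β 1) := fun α β => by
    unfold coordDeriv
    rw [fderiv_clm_apply hd (differentiableAt_const _)]
    simp
  rw [key, key, hs.eq]

lemma coordDeriv_mul {F G : (Fin 4 → ℝ) → ℝ} {x : Fin 4 → ℝ} (hF : DifferentiableAt ℝ F x)
    (hG : DifferentiableAt ℝ G x) (μ : Fin 4) :
    coordDeriv μ (fun y => F y * G y) x =
      F x * coordDeriv μ G x + coordDeriv μ F x * G x := by
  unfold coordDeriv
  rw [fderiv_fun_mul hF hG]
  simp [mul_comm]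

lemma coordDeriv_sum {ι : Type*} {s : Finset ι} {F : ι → (Fin 4 → ℝ) → ℝ} {x : Fin 4 → ℝ}
    (hF : ∀ i ∈ s, DifferentiableAt ℝ (F i) x) (μ : Fin 4) :
    coordDeriv μ (fun y => ∑ i ∈ s, F i y) x = ∑ i ∈ s, coordDeriv μ (F i) x := by
  unfold coordDeriv
  rw [fderiv_fun_sum hF]
  simp

lemma coordDeriv_sub {F G : (Fin 4 → ℝ) → ℝ} {x : Fin 4 → ℝ} (hF : DifferentiableAt ℝ F x)
    (hG : DifferentiableAt ℝ G x) (μ : Fin 4) :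
    coordDeriv μ (fun y => F y - G y) x = coordDeriv μ F x - coordDeriv μ G x := by
  unfold coordDeriv
  rw [fderiv_fun_sub hF hG]
  simp

lemma coordDeriv_const_mul {F : (Fin 4 → ℝ) → ℝ} {x : Fin 4 → ℝ} (hF : DifferentiableAt ℝ F x)
    (c : ℝ) (μ : Fin 4) :
    coordDeriv μ (fun y => c * F y) x = c * coordDeriv μ F x := by
  unfold coordDeriv
  rw [fderiv_const_mul hF]
  simp

lemma contDiff_matrix_det {E n : Type*} [NormedAddCommGroup E] [NormedSpace ℝ E] [Fintype n]
    [DecidableEq n] {k : WithTop ℕ∞} {A : E → Matrix n n ℝ}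
    (hA : ∀ i j, ContDiff ℝ k fun x => A x i j) : ContDiff ℝ k fun x => (A x).det := by
  simp only [Matrix.det_apply']
  exact ContDiff.sum fun σ _ => contDiff_const.mul (contDiff_prod fun i _ => hA _ _)

lemma contDiff_matrix_inv {E n : Type*} [NormedAddCommGroup E] [NormedSpace ℝ E] [Fintype n]
    [DecidableEq n] {k : WithTop ℕ∞} {A : E → Matrix n n ℝ}
    (hA : ∀ i j, ContDiff ℝ k fun x => A x i j) (hdet : ∀ x, IsUnit (A x).det) (i j : n) :
    ContDiff ℝ k fun x => (A x)⁻¹ i j := by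
  simp only [Matrix.inv_def, Matrix.smul_apply, Ring.inverse_eq_inv', smul_eq_mul]
  refine ((contDiff_matrix_det hA).inv fun x => (hdet x).ne_zero).mul ?_
  simp only [Matrix.adjugate_apply]
  refine contDiff_matrix_det fun a b => ?_
  by_cases h : a = j
  · subst h
    simpa using contDiff_const
  · simpa [Matrix.updateRow_ne h] using hA a b

section Metric

variable {g : (Fin 4 → ℝ) → Matrix (Fin 4) (Fin 4) ℝ}

lemma coordDeriv_inv (hg : ∀ μ ν : Fin 4, ContDiff ℝ (⊤ : ℕ∞) fun x => g x μ ν)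
    (hdet : ∀ x, IsUnit (g x).det) (μ σ τ : Fin 4) (x : Fin 4 → ℝ) :
    coordDeriv μ (fun y => (g y)⁻¹ σ τ) x =
      -∑ a, ∑ b, (g x)⁻¹ σ a * coordDeriv μ (fun y => g y a b) x * (g x)⁻¹ b τ := by
  have dg a b : Differentiable ℝ fun y => g y a b := (hg a b).differentiable (by simp)
  have dh a b : Differentiable ℝ fun y => (g y)⁻¹ a b :=
    (contDiff_matrix_inv hg hdet a b).differentiable (by simp)
  let D : Matrix (Fin 4) (Fin 4) ℝ := Matrix.of fun a b => coordDeriv μ (fun y => g y a b) x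
  let K : Matrix (Fin 4) (Fin 4) ℝ := Matrix.of fun a b => coordDeriv μ (fun y => (g y)⁻¹ a b) x
  have h : g x * K + D * (g x)⁻¹ = 0 := by
    ext a b
    have hc : (fun y => ∑ c, g y a c * (g y)⁻¹ c b) =
        fun _ => (1 : Matrix (Fin 4) (Fin 4) ℝ) a b := by
      funext y
      rw [← Matrix.mul_apply, Matrix.mul_nonsing_inv _ (hdet y)]
    have hz : coordDeriv μ (fun y => ∑ c, g y a c * (g y)⁻¹ c b) x = 0 := by
      rw [hc]
      simp [coordDeriv]
    rw [coordDeriv_sum fun c _ => ((dg a c).fun_mul (dh c b)) x] at hz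
    simp only [coordDeriv_mul (dg _ _ x) (dh _ _ x), Finset.sum_add_distrib] at hz
    simpa [Matrix.mul_apply, D, K] using hz
  have hK : K = -((g x)⁻¹ * D * (g x)⁻¹) := by
    rw [Matrix.mul_assoc, ← Matrix.mul_neg, ← eq_neg_of_add_eq_zero_left h, ← Matrix.mul_assoc,
      Matrix.nonsing_inv_mul _ (hdet x), Matrix.one_mul]
  have := congrFun (congrFun hK σ) τ
  simp only [K, D, Matrix.of_apply, Matrix.neg_apply, Matrix.mul_apply] at this
  rw [this]
  simp only [Finset.sum_mul]
  rw [Finset.sum_comm]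

lemma Christoffel_symm (hsymm : ∀ x, (g x).IsSymm) (σ μ ν : Fin 4) :
    Christoffel g σ μ ν = Christoffel g σ ν μ := by
  have h : (fun y => g y μ ν) = fun y => g y ν μ := funext fun y => (hsymm y).apply _ _
  funext x
  simp only [Christoffel, h]
  congr 1
  exact Finset.sum_congr rfl fun τ _ => by ring

lemma contDiff_Christoffel (hg : ∀ μ ν : Fin 4, ContDiff ℝ (⊤ : ℕ∞) fun x => g x μ ν)
    (hdet : ∀ x, IsUnit (g x).det) (σ μ ν : Fin 4) :
    ContDiff ℝ (⊤ : ℕ∞) (Christoffel g σ μ ν) := by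
  unfold Christoffel
  exact contDiff_const.mul (ContDiff.sum fun τ _ => (contDiff_matrix_inv hg hdet σ τ).mul
    (((contDiff_coordDeriv (hg τ ν) μ).add (contDiff_coordDeriv (hg τ μ) ν)).sub
      (contDiff_coordDeriv (hg μ ν) τ)))

lemma coordDeriv_Christoffel (hg : ∀ μ ν : Fin 4, ContDiff ℝ (⊤ : ℕ∞) fun x => g x μ ν)
    (hdet : ∀ x, IsUnit (g x).det) (κ σ μ : Fin 4) (x : Fin 4 → ℝ) :
    coordDeriv κ (Christoffel g σ μ μ) x = (1 / 2) * ∑ τ,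
      ((g x)⁻¹ σ τ * (2 * coordDeriv κ (coordDeriv μ fun y => g y τ μ) x -
          coordDeriv κ (coordDeriv τ fun y => g y μ μ) x) +
        coordDeriv κ (fun y => (g y)⁻¹ σ τ) x *
          (2 * coordDeriv μ (fun y => g y τ μ) x - coordDeriv τ (fun y => g y μ μ) x)) := by
  have dh a b : Differentiable ℝ fun y => (g y)⁻¹ a b :=
    (contDiff_matrix_inv hg hdet a b).differentiable (by simp)
  have d1 a b c : Differentiable ℝ (coordDeriv c fun y => g y a b) :=
    (contDiff_coordDeriv (hg a b) c).differentiable (by simp)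
  have hΓ : Christoffel g σ μ μ = fun x => (1 / 2) * ∑ τ, (g x)⁻¹ σ τ *
      (2 * coordDeriv μ (fun y => g y τ μ) x - coordDeriv τ (fun y => g y μ μ) x) := by
    funext x
    simp only [Christoffel, two_mul]
  have dT τ : Differentiable ℝ fun x =>
      2 * coordDeriv μ (fun y => g y τ μ) x - coordDeriv τ (fun y => g y μ μ) x :=
    ((d1 τ μ μ).const_mul 2).sub (d1 μ μ τ)
  rw [hΓ, coordDeriv_const_mul (DifferentiableAt.fun_sum fun τ _ => ((dh σ τ).fun_mul (dT τ)) x),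
    coordDeriv_sum fun τ _ => ((dh σ τ).fun_mul (dT τ)) x]
  congr 1
  refine Finset.sum_congr rfl fun τ _ => ?_
  rw [coordDeriv_mul (dh σ τ x) (dT τ x),
    coordDeriv_sub (((d1 τ μ μ).const_mul 2) x) (d1 μ μ τ x),
    coordDeriv_const_mul (d1 τ μ μ x)]

end Metric


/-- On the null hypersurface `u = 0`, if the metric takes the adapted form
`ds² = −2 du dr + r²ρ̄(y)·e_{ij}(r,y) dyⁱ dyʲ` (with `e` symmetric unimodular), then
`R₁₁ = (2/r)·Γ¹₁₁ + ¼·trace(∂ᵣe · ∂ᵣ(e⁻¹))` and `Γ¹₁₁ = ½·∂₀ g₁₁` there (indices: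
`x⁰ = u`, `x¹ = r`).  This is the identity behind the equivalence of the Einstein
equation `G_rr = 0` with `Γʳ_rr = −(r/8)·∂ᵣe_{ij}·∂ᵣe^{ij}`. -/
theorem Ricci_rr_adapted_null_form
    (g : (Fin 4 → ℝ) → Matrix (Fin 4) (Fin 4) ℝ)
    (hg_smooth : ∀ μ ν : Fin 4, ContDiff ℝ (⊤ : ℕ∞) fun x => g x μ ν)
    (hg_symm : ∀ x, (g x).IsSymm)
    (hg_inv : ∀ x, IsUnit (g x).det)
    (U : Set (ℝ × ℝ × ℝ)) (hU_open : IsOpen U)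
    (hU_pos : ∀ p ∈ U, 0 < p.1)
    (e : ℝ → ℝ → ℝ → Matrix (Fin 2) (Fin 2) ℝ)
    (he_smooth : ∀ i j : Fin 2,
      ContDiffOn ℝ (⊤ : ℕ∞) (fun p : ℝ × ℝ × ℝ => e p.1 p.2.1 p.2.2 i j) U)
    (he_symm : ∀ p ∈ U, (e p.1 p.2.1 p.2.2).IsSymm)
    (he_det : ∀ p ∈ U, (e p.1 p.2.1 p.2.2).det = 1)
    (ρbar : ℝ → ℝ → ℝ) (hρbar : ∀ y₁ y₂ : ℝ, ρbar y₁ y₂ ≠ 0)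
    (hmetric : ∀ p ∈ U,
      g ![0, p.1, p.2.1, p.2.2] =
        !![0, -1, 0, 0;
           -1, 0, 0, 0;
           0, 0, p.1 ^ 2 * ρbar p.2.1 p.2.2 * e p.1 p.2.1 p.2.2 0 0,
                 p.1 ^ 2 * ρbar p.2.1 p.2.2 * e p.1 p.2.1 p.2.2 0 1;
           0, 0, p.1 ^ 2 * ρbar p.2.1 p.2.2 * e p.1 p.2.1 p.2.2 1 0,
                 p.1 ^ 2 * ρbar p.2.1 p.2.2 * e p.1 p.2.1 p.2.2 1 1]) :
    ∀ p ∈ U,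
      Ricci g 1 1 ![0, p.1, p.2.1, p.2.2] =
          (2 / p.1) * Christoffel g 1 1 1 ![0, p.1, p.2.1, p.2.2] +
            (1 / 4) * Matrix.trace
              ((Matrix.of fun i j : Fin 2 => deriv (fun s => e s p.2.1 p.2.2 i j) p.1) *
                (Matrix.of fun i j : Fin 2 => deriv (fun s => (e s p.2.1 p.2.2)⁻¹ i j) p.1)) ∧
        Christoffel g 1 1 1 ![0, p.1, p.2.1, p.2.2] =
          (1 / 2) * coordDeriv 0 (fun x => g x 1 1) ![0, p.1, p.2.1, p.2.2] := by
  intro p hp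
  have dg a b : Differentiable ℝ fun y => g y a b := (hg_smooth a b).differentiable (by simp)
  have dd a b c : Differentiable ℝ (coordDeriv c fun y => g y a b) :=
    (contDiff_coordDeriv (hg_smooth a b) c).differentiable (by simp)
  have dΓ a b c : Differentiable ℝ (Christoffel g a b c) :=
    (contDiff_Christoffel hg_smooth hg_inv a b c).differentiable (by simp)
  have he10 : ∀ q ∈ U, e q.1 q.2.1 q.2.2 1 0 = e q.1 q.2.1 q.2.2 0 1 := fun q hq =>
    (he_symm q hq).apply 0 1
  have hdet : ∀ q ∈ U, e q.1 q.2.1 q.2.2 0 0 * e q.1 q.2.1 q.2.2 1 1 -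
      e q.1 q.2.1 q.2.2 0 1 * e q.1 q.2.1 q.2.2 1 0 = 1 := fun q hq => by
    rw [← Matrix.det_fin_two, he_det q hq]
  have hH : ∀ q ∈ U, (g ![0, q.1, q.2.1, q.2.2])⁻¹ =
      let c := (q.1 ^ 2 * ρbar q.2.1 q.2.2)⁻¹
      !![0, -1, 0, 0;
         -1, 0, 0, 0;
         0, 0, c * e q.1 q.2.1 q.2.2 1 1, -(c * e q.1 q.2.1 q.2.2 0 1);
         0, 0, -(c * e q.1 q.2.1 q.2.2 1 0), c * e q.1 q.2.1 q.2.2 0 0] := by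
    intro q hq
    have hr := (hU_pos q hq).ne'
    have hρ := hρbar q.2.1 q.2.2
    have h := hdet q hq
    refine Matrix.inv_eq_right_inv ?_
    rw [hmetric q hq]
    ext i j
    fin_cases i <;> fin_cases j <;> simp [Matrix.mul_apply, Fin.sum_univ_four] <;>
      field_simp <;> first | ring1 | linear_combination h
  have hz : ∀ q ∈ U, ∀ μ : Fin 4, μ ≠ 0 → ∀ a b : Fin 4, a < 2 ∨ b < 2 →
      coordDeriv μ (fun y => g y a b) ![0, q.1, q.2.1, q.2.2] = 0 := by
    intro q hq μ hμ a b hab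
    refine coordDeriv_eq_zero_of_slice_const (c := if a + b = 1 then -1 else 0)
      hU_open (dg a b) (fun q' hq' => ?_) hq hμ
    rw [hmetric q' hq']
    fin_cases a <;> fin_cases b <;> first | rfl | simp_all
  have hde : ∀ q ∈ U, ∀ i j, HasDerivAt (fun s => e s q.2.1 q.2.2 i j)
      (deriv (fun s => e s q.2.1 q.2.2 i j) q.1) q.1 := by
    intro q hq i j
    have h1 := ((he_smooth i j).contDiffAt (hU_open.mem_nhds hq)).differentiableAt (by simp)
    exact (h1.comp (f := fun s : ℝ => (s, q.2)) q.1 (by fun_prop)).hasDerivAt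
  have hq1 : ∀ q ∈ U, ∀ i j : Fin 2,
      coordDeriv 1 (fun y => g y (Fin.natAdd 2 i) (Fin.natAdd 2 j)) ![0, q.1, q.2.1, q.2.2] =
        2 * q.1 * ρbar q.2.1 q.2.2 * e q.1 q.2.1 q.2.2 i j +
          q.1 ^ 2 * ρbar q.2.1 q.2.2 * deriv (fun s => e s q.2.1 q.2.2 i j) q.1 := by
    intro q hq i j
    refine coordDeriv_one_of_slice hU_open
      (f := fun q => q.1 ^ 2 * ρbar q.2.1 q.2.2 * e q.1 q.2.1 q.2.2 i j) (dg _ _)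
      (fun q' hq' => ?_) hq ?_
    · rw [hmetric q' hq']
      fin_cases i <;> fin_cases j <;> rfl
    · exact (((hasDerivAt_pow 2 q.1).mul_const (ρbar q.2.1 q.2.2)).mul (hde q hq i j)).congr_deriv
        (by simp)
  have h22 q (hq : q ∈ U) := hq1 q hq 0 0
  have h23 q (hq : q ∈ U) := hq1 q hq 0 1
  have h32 q (hq : q ∈ U) := hq1 q hq 1 0
  have h33 q (hq : q ∈ U) := hq1 q hq 1 1
  simp only [show Fin.natAdd 2 (0 : Fin 2) = (2 : Fin 4) from rfl,
    show Fin.natAdd 2 (1 : Fin 2) = (3 : Fin 4) from rfl] at h22 h23 h32 h33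
  have hline : ∀ q ∈ U, ∀ᶠ s in 𝓝 q.1, (s, q.2) ∈ U := fun q hq =>
    (by fun_prop : Continuous fun s : ℝ => (s, q.2)).continuousAt.eventually
      (hU_open.mem_nhds hq)
  have hd10 : ∀ q ∈ U, deriv (fun s => e s q.2.1 q.2.2 1 0) q.1 =
      deriv (fun s => e s q.2.1 q.2.2 0 1) q.1 := fun q hq =>
    Filter.EventuallyEq.deriv_eq ((hline q hq).mono fun s hs => he10 _ hs)
  have htr : ∀ q ∈ U,
      deriv (fun s => e s q.2.1 q.2.2 0 0) q.1 * e q.1 q.2.1 q.2.2 1 1 +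
        e q.1 q.2.1 q.2.2 0 0 * deriv (fun s => e s q.2.1 q.2.2 1 1) q.1 -
        2 * (e q.1 q.2.1 q.2.2 0 1 * deriv (fun s => e s q.2.1 q.2.2 0 1) q.1) = 0 := by
    intro q hq
    have h1 := ((hde q hq 0 0).mul (hde q hq 1 1)).sub ((hde q hq 0 1).mul (hde q hq 1 0))
    have h2 := h1.unique ((hasDerivAt_const q.1 (1 : ℝ)).congr_of_eventuallyEq
      ((hline q hq).mono fun s hs => hdet _ hs))
    rw [hd10 q hq, he10 q hq] at h2
    linear_combination h2
  have hinv : ∀ i j, deriv (fun s => (e s p.2.1 p.2.2)⁻¹ i j) p.1 =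
      deriv (fun s => (e s p.2.1 p.2.2).adjugate i j) p.1 := fun i j =>
    Filter.EventuallyEq.deriv_eq ((hline p hp).mono fun s hs => by
      simp [Matrix.inv_def, he_det _ hs])
  -- Christoffel symbols on the slice
  have Γ011 : ∀ q ∈ U, Christoffel g 0 1 1 ![0, q.1, q.2.1, q.2.2] = 0 := fun q hq => by
    simp [Christoffel, Fin.sum_univ_four, hH q hq, hz q hq]
  have Γ111 : ∀ q ∈ U, Christoffel g 1 1 1 ![0, q.1, q.2.1, q.2.2] =
      (1 / 2) * coordDeriv 0 (fun x => g x 1 1) ![0, q.1, q.2.1, q.2.2] := fun q hq => by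
    simp [Christoffel, Fin.sum_univ_four, hH q hq, hz q hq]
  have Γ211 : ∀ q ∈ U, Christoffel g 2 1 1 ![0, q.1, q.2.1, q.2.2] = 0 := fun q hq => by
    simp [Christoffel, Fin.sum_univ_four, hH q hq, hz q hq]
  have Γ311 : ∀ q ∈ U, Christoffel g 3 1 1 ![0, q.1, q.2.1, q.2.2] = 0 := fun q hq => by
    simp [Christoffel, Fin.sum_univ_four, hH q hq, hz q hq]
  have Γ010 : ∀ q ∈ U, Christoffel g 0 1 0 ![0, q.1, q.2.1, q.2.2] =
      -(1 / 2) * coordDeriv 0 (fun x => g x 1 1) ![0, q.1, q.2.1, q.2.2] := fun q hq => by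
    simp [Christoffel, Fin.sum_univ_four, hH q hq, hz q hq]
  have Γ012 : ∀ q ∈ U, Christoffel g 0 1 2 ![0, q.1, q.2.1, q.2.2] = 0 := fun q hq => by
    simp [Christoffel, Fin.sum_univ_four, hH q hq, hz q hq]
  have Γ013 : ∀ q ∈ U, Christoffel g 0 1 3 ![0, q.1, q.2.1, q.2.2] = 0 := fun q hq => by
    simp [Christoffel, Fin.sum_univ_four, hH q hq, hz q hq]
  have Γtr : ∀ q ∈ U, ∑ α, Christoffel g α α 1 ![0, q.1, q.2.1, q.2.2] = 2 / q.1 := by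
    intro q hq
    have hr := (hU_pos q hq).ne'
    have hρ := hρbar q.2.1 q.2.2
    have h := hdet q hq
    have h' := htr q hq
    simp [Christoffel, Fin.sum_univ_four, hH q hq, hz q hq, h22 q hq, h23 q hq, h32 q hq,
      h33 q hq, hd10 q hq, he10 q hq] at h ⊢
    field_simp
    linear_combination 4 * h + q.1 * h'
  have D011 : coordDeriv 0 (Christoffel g 0 1 1) ![0, p.1, p.2.1, p.2.2] =
      (1 / 2) * coordDeriv 0 (fun x => g x 1 1) ![0, p.1, p.2.1, p.2.2] ^ 2 -
        (1 / 2) * coordDeriv 0 (coordDeriv 1 fun x => g x 1 1) ![0, p.1, p.2.1, p.2.2] := by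
    rw [coordDeriv_Christoffel hg_smooth hg_inv]
    simp [Fin.sum_univ_four, coordDeriv_inv hg_smooth hg_inv, hH p hp, hz p hp]
    ring
  have D111 : coordDeriv 1 (Christoffel g 1 1 1) ![0, p.1, p.2.1, p.2.2] =
      (1 / 2) * coordDeriv 0 (coordDeriv 1 fun x => g x 1 1) ![0, p.1, p.2.1, p.2.2] := by
    have h := coordDeriv_eq_zero_of_slice_const hU_open (c := 0) (μ := 1)
      ((dΓ 1 1 1).fun_sub ((dd 1 1 0).const_mul (1 / 2)))
      (fun q hq => sub_eq_zero.2 (Γ111 q hq)) hp (by decide)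
    rw [coordDeriv_sub (dΓ 1 1 1 _) (((dd 1 1 0).const_mul (1 / 2)) _),
      coordDeriv_const_mul (dd 1 1 0 _), coordDeriv_comm (hg_smooth 1 1)] at h
    linear_combination h
  have D211 : coordDeriv 2 (Christoffel g 2 1 1) ![0, p.1, p.2.1, p.2.2] = 0 :=
    coordDeriv_eq_zero_of_slice_const hU_open (dΓ 2 1 1) Γ211 hp (by decide)
  have D311 : coordDeriv 3 (Christoffel g 3 1 1) ![0, p.1, p.2.1, p.2.2] = 0 :=
    coordDeriv_eq_zero_of_slice_const hU_open (dΓ 3 1 1) Γ311 hp (by decide)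
  have hr := (hU_pos p hp).ne'
  have Dtr : ∑ α, coordDeriv 1 (Christoffel g α α 1) ![0, p.1, p.2.1, p.2.2] =
      -2 / p.1 ^ 2 := by
    rw [← coordDeriv_sum fun α _ => dΓ α α 1 _]
    refine coordDeriv_one_of_slice hU_open (f := fun q => 2 / q.1)
      (Differentiable.fun_sum fun α _ => dΓ α α 1) Γtr hp ?_
    exact ((hasDerivAt_inv hr).const_mul 2).congr_deriv (by ring)
  have hquad : ∑ i : Fin 2, ∑ j : Fin 2,
      Christoffel g (Fin.natAdd 2 i) 1 (Fin.natAdd 2 j) ![0, p.1, p.2.1, p.2.2] *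
        Christoffel g (Fin.natAdd 2 j) 1 (Fin.natAdd 2 i) ![0, p.1, p.2.1, p.2.2] =
      2 / p.1 ^ 2 - (1 / 2) * (deriv (fun s => e s p.2.1 p.2.2 0 0) p.1 *
        deriv (fun s => e s p.2.1 p.2.2 1 1) p.1 -
          deriv (fun s => e s p.2.1 p.2.2 0 1) p.1 ^ 2) := by
    have hρ := hρbar p.2.1 p.2.2
    have h := hdet p hp
    have h' := htr p hp
    simp only [Fin.sum_univ_two, show Fin.natAdd 2 (0 : Fin 2) = (2 : Fin 4) from rfl,
      show Fin.natAdd 2 (1 : Fin 2) = (3 : Fin 4) from rfl]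
    simp [Christoffel, Fin.sum_univ_four, hH p hp, hz p hp, h22 p hp, h23 p hp, h32 p hp,
      h33 p hp, hd10 p hp, he10 p hp] at h ⊢
    field_simp
    generalize e p.1 p.2.1 p.2.2 0 0 = a, e p.1 p.2.1 p.2.2 0 1 = b,
      e p.1 p.2.1 p.2.2 1 1 = d, deriv (fun s => e s p.2.1 p.2.2 0 0) p.1 = a',
      deriv (fun s => e s p.2.1 p.2.2 0 1) p.1 = b',
      deriv (fun s => e s p.2.1 p.2.2 1 1) p.1 = d' at h h' ⊢
    linear_combination (8 * (a * d - b * b + 1) - 2 * p.1 ^ 2 * (a' * d' - b' ^ 2)) * h +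
      (4 * p.1 * (a * d - b * b) + p.1 ^ 2 * (a' * d + a * d' - 2 * (b * b'))) * h'
  have htrace : Matrix.trace
      ((Matrix.of fun i j : Fin 2 => deriv (fun s => e s p.2.1 p.2.2 i j) p.1) *
        (Matrix.of fun i j : Fin 2 => deriv (fun s => (e s p.2.1 p.2.2)⁻¹ i j) p.1)) =
      2 * (deriv (fun s => e s p.2.1 p.2.2 0 0) p.1 *
        deriv (fun s => e s p.2.1 p.2.2 1 1) p.1 -
          deriv (fun s => e s p.2.1 p.2.2 0 1) p.1 ^ 2) := by
    simp [Matrix.trace_fin_two, Matrix.mul_apply, hinv, Matrix.adjugate_fin_two, hd10 p hp]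
    ring
  refine ⟨?_, Γ111 p hp⟩
  have htr' := Γtr p hp
  rw [htrace, Ricci, Dtr]
  simp only [Finset.sum_sub_distrib]
  rw [Finset.sum_comm]
  simp only [← Finset.sum_mul]
  simp only [Fin.sum_univ_two, show Fin.natAdd 2 (0 : Fin 2) = (2 : Fin 4) from rfl,
      show Fin.natAdd 2 (1 : Fin 2) = (3 : Fin 4) from rfl] at hquad
  simp only [Fin.sum_univ_four, Christoffel_symm hg_symm _ _ 1] at htr' ⊢
  rw [Γ010 p hp, Γ111 p hp] at htr'
  rw [D011, D111, D211, D311, Γ011 p hp, Γ111 p hp, Γ211 p hp, Γ311 p hp, Γ010 p hp, Γ012 p hp,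
    Γ013 p hp]
  linear_combination (1 / 2) * coordDeriv 0 (fun x => g x 1 1) ![0, p.1, p.2.1, p.2.2] * htr' -
    hquad
end
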